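/- Let 𝔤 be a finite-dimensional perfect complex Lie algebra, U = U(𝔤) its universal enveloping algebra, and ε : U → ℂ the counit. Let g₁,…,gₙ be central elements of U lying in ker ε such that: (i) the center Z(U) is, as a ℂ-subalgebra of U, generated by g₁,…,gₙ; (ii) for every index j, the image of g_j in the quotient ring U/⟨g_i : i ≠ j⟩ is not a zero divisor; (iii) ⋂_{m ≥ 1} Iᵐ = 0, where I is the two-sided ideal of U generated by g₁,…,gₙ. If φ is a ℂ-algebra automorphism of U which is semisimple as a ℂ-linear endomorphism of U and satisfies φ(x) − x ∈ I for every x ∈ U, then φ is the identity automorphism. -/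

import Mathlib

namespace SemisimpleAut

variable {A : Type*} [Ring A] [Algebra ℂ A]

/-- The map `c ↦ ∑ g j * c j`. -/
noncomputable def comb {n : ℕ} (g : Fin n → A) : (Fin n → A) →ₗ[ℂ] A :=
  ∑ j, (LinearMap.mulLeft ℂ (g j)).comp (LinearMap.proj j)

theorem comb_apply {n : ℕ} (g : Fin n → A) (c : Fin n → A) :
    comb g c = ∑ j, g j * c j := by
  simp [comb, LinearMap.sum_apply]

theorem comb_mul {n : ℕ} (g : Fin n → A) (c : Fin n → A) (u : A) :
    comb g c * u = comb g (fun j => c j * u) := by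
  simp [comb_apply, Finset.sum_mul, mul_assoc]

theorem mul_comb {n : ℕ} (g : Fin n → A) (hg : ∀ i u, u * g i = g i * u)
    (c : Fin n → A) (u : A) :
    u * comb g c = comb g (fun j => u * c j) := by
  simp only [comb_apply, Finset.mul_sum, ← mul_assoc, hg]

theorem ideal_eq {n : ℕ} (g : Fin n → A) (hg : ∀ i u, u * g i = g i * u)
    (I : Submodule ℂ A)
    (hI : I = Submodule.span ℂ {x : A | ∃ i, ∃ u v : A, x = u * g i * v}) :
    I = LinearMap.range (comb g) := by
  subst hI
  apply le_antisymm
  · rw [Submodule.span_le]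
    rintro x ⟨i, u, v, rfl⟩
    refine ⟨Pi.single i (u * v), ?_⟩
    rw [comb_apply, Finset.sum_eq_single i]
    · simp [hg, mul_assoc]
    · intro b _ hb
      simp [hb]
    · simp
  · rintro _ ⟨c, rfl⟩
    rw [comb_apply]
    exact Submodule.sum_mem _ fun j _ => Submodule.subset_span ⟨j, 1, c j, by simp⟩

/-- A semisimple endomorphism acting trivially on all graded pieces is the identity. -/
theorem eq_of_filtration {V : Type*} [AddCommGroup V] [Module ℂ V] (f : Module.End ℂ V)
    (hss : f.IsSemisimple) (F : ℕ → Submodule ℂ V) (h0 : F 0 = ⊤)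
    (hle : ∀ k, F (k + 1) ≤ F k)
    (hF : ∀ k, ∀ x ∈ F k, f x - x ∈ F (k + 1)) (hbot : (⨅ m : ℕ, F (m + 1)) = ⊥) (v : V) :
    f v = v := by
  have hinv : ∀ k, ∀ x ∈ F k, f x ∈ F k := fun k x hx => by
    have := (F k).add_mem (hle k (hF k x hx)) hx
    simpa using this
  have key : ∀ k, ∃ d w, v = d + w ∧ f d = d ∧ w ∈ F k := by
    intro k
    induction k with
    | zero => exact ⟨0, v, by simp, by simp, by simp [h0]⟩
    | succ k ih =>
      obtain ⟨d, w, rfl, hd, hw⟩ := ih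
      obtain ⟨q, hq, hc⟩ := Module.End.isSemisimple_iff.mp hss (F (k + 1))
        (fun x hx => hinv _ x hx)
      have hw' : w ∈ F (k + 1) ⊔ q := by rw [hc.sup_eq_top]; trivial
      obtain ⟨a, ha, b, hb, rfl⟩ := Submodule.mem_sup.mp hw'
      refine ⟨d + b, a, by abel, ?_, ha⟩
      have hbk : b ∈ F k := by
        have := (F k).sub_mem hw (hle k ha)
        simpa using this
      have h1 := hF k b hbk
      have h2 : f b - b ∈ q := q.sub_mem (hq hb) hb
      have h3 : f b - b ∈ F (k + 1) ⊓ q := ⟨h1, h2⟩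
      rw [hc.inf_eq_bot, Submodule.mem_bot, sub_eq_zero] at h3
      rw [map_add, hd, h3]
  have : f v - v ∈ (⨅ m : ℕ, F (m + 1)) := by
    rw [Submodule.mem_iInf]
    intro m
    obtain ⟨d, w, rfl, hd, hw⟩ := key m
    have := hF m w hw
    rw [map_add, hd]
    simpa using this
  rw [hbot, Submodule.mem_bot, sub_eq_zero] at this
  exact this

section

attribute [local instance] LieRing.ofAssociativeRing LieAlgebra.ofAssociativeAlgebra

theorem ι_lie (L : Type*) [LieRing L] [LieAlgebra ℂ L] (a b : L) :
    UniversalEnvelopingAlgebra.ι ℂ ⁅a, b⁆ =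
      UniversalEnvelopingAlgebra.ι ℂ a * UniversalEnvelopingAlgebra.ι ℂ b -
      UniversalEnvelopingAlgebra.ι ℂ b * UniversalEnvelopingAlgebra.ι ℂ a := by
  rw [LieHom.map_lie, LieRing.of_associative_ring_bracket]

theorem mem_of_ι_mem {L : Type*} [LieRing L] [LieAlgebra ℂ L]
    (P : Subalgebra ℂ (UniversalEnvelopingAlgebra ℂ L))
    (hPι : ∀ x : L, UniversalEnvelopingAlgebra.ι ℂ x ∈ P) :
    ∀ x, x ∈ P := by
  let f : L →ₗ⁅ℂ⁆ P :=
    { toFun := fun x => ⟨UniversalEnvelopingAlgebra.ι ℂ x, hPι x⟩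
      map_add' := fun a b => Subtype.ext (by simp)
      map_smul' := fun r a => Subtype.ext (by simp)
      map_lie' := fun {a b} => Subtype.ext (by
        simp [LieRing.of_associative_ring_bracket]) }
  have hcomp : P.val.comp (UniversalEnvelopingAlgebra.lift ℂ f) = AlgHom.id ℂ _ := by
    apply UniversalEnvelopingAlgebra.hom_ext
    ext x
    simp [f]
  intro x
  have := congrArg (fun h => h x) hcomp
  simp only [AlgHom.comp_apply, AlgHom.id_apply] at this
  rw [← this]
  exact (UniversalEnvelopingAlgebra.lift ℂ f x).2

end

end SemisimpleAut

/-- Let `𝔤` be a finite-dimensional perfect complex Lie algebra,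
`U = U(𝔤)`, `ε` the counit, and `g₁,…,gₙ` central elements of `ker ε` such that:
(i) the center `Z(U)` is generated as a `ℂ`-subalgebra by the `gᵢ`;
(ii) for each `j`, the image of `g j` in `U/⟨g i : i ≠ j⟩` is not a zero divisor;
(iii) `⋂_{m ≥ 1} Iᵐ = 0` for `I` the two-sided ideal generated by the `gᵢ`
(viewed as a `ℂ`-submodule, so that powers make sense).
Then any `ℂ`-algebra automorphism `φ` of `U` which is semisimple as a `ℂ`-linear
endomorphism and satisfies `φ(x) − x ∈ I` for all `x` is the identity. -/
theorem semisimple_automorphism_trivial_on_filtration_eq_id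
    (L : Type*) [LieRing L] [LieAlgebra ℂ L] [Module.Finite ℂ L]
    (hperf : LieAlgebra.derivedSeries ℂ L 1 = ⊤)
    (ε : UniversalEnvelopingAlgebra ℂ L →ₐ[ℂ] ℂ)
    (hε : ∀ x : L, ε (UniversalEnvelopingAlgebra.ι ℂ x) = 0)
    (n : ℕ) (g : Fin n → UniversalEnvelopingAlgebra ℂ L)
    (hgc : ∀ i, g i ∈ Subalgebra.center ℂ (UniversalEnvelopingAlgebra ℂ L))
    (hgε : ∀ i, ε (g i) = 0)
    (hgen : Subalgebra.center ℂ (UniversalEnvelopingAlgebra ℂ L) =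
      Algebra.adjoin ℂ (Set.range g))
    (J : Fin n → TwoSidedIdeal (UniversalEnvelopingAlgebra ℂ L))
    (hJ : ∀ j, J j = TwoSidedIdeal.span (g '' {i | i ≠ j}))
    (hreg : ∀ j, ∀ u : (J j).ringCon.Quotient,
      ((J j).ringCon.mk' (g j) * u = 0 → u = 0) ∧
      (u * (J j).ringCon.mk' (g j) = 0 → u = 0))
    (I : Submodule ℂ (UniversalEnvelopingAlgebra ℂ L))
    (hI : I = Submodule.span ℂ
      {x : UniversalEnvelopingAlgebra ℂ L | ∃ i, ∃ u v : UniversalEnvelopingAlgebra ℂ L,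
        x = u * g i * v})
    (hint : (⨅ m : ℕ, I ^ (m + 1)) = ⊥)
    (φ : UniversalEnvelopingAlgebra ℂ L ≃ₐ[ℂ] UniversalEnvelopingAlgebra ℂ L)
    (hss : Module.End.IsSemisimple φ.toLinearMap)
    (hφ : ∀ x : UniversalEnvelopingAlgebra ℂ L, φ x - x ∈ I) :
    φ = AlgEquiv.refl := by
  classical
  have hg : ∀ i u, u * g i = g i * u := fun i u =>
    Subalgebra.mem_center_iff.mp (hgc i) u
  have hIr := SemisimpleAut.ideal_eq g hg I hI
  have hIε : ∀ x ∈ I, ε x = 0 := by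
    intro x hx
    rw [hIr] at hx
    obtain ⟨c, rfl⟩ := hx
    simp [SemisimpleAut.comb_apply, hgε]
  have hIg : ∀ i, g i ∈ I := fun i => by
    rw [hI]; exact Submodule.subset_span ⟨i, 1, 1, by simp⟩
  have hImul : ∀ x ∈ I, ∀ u, x * u ∈ I := by
    intro x hx u
    rw [hIr] at hx ⊢
    obtain ⟨c, rfl⟩ := hx
    exact ⟨_, (SemisimpleAut.comb_mul g c u).symm⟩
  have hmulI : ∀ x ∈ I, ∀ u, u * x ∈ I := by
    intro x hx u
    rw [hIr] at hx ⊢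
    obtain ⟨c, rfl⟩ := hx
    exact ⟨_, (SemisimpleAut.mul_comb g hg c u).symm⟩
  -- elements of `I * I`
  have hII : ∀ x ∈ I * I, ∃ c, (∀ j, ε (c j) = 0) ∧ SemisimpleAut.comb g c = x := by
    intro x hx
    induction hx using Submodule.mul_induction_on' with
    | mem_mul_mem a ha b hb =>
      rw [hIr] at ha
      obtain ⟨c, rfl⟩ := ha
      exact ⟨_, fun j => by simp [hIε b hb], (SemisimpleAut.comb_mul g c b).symm⟩
    | add a _ b _ iha ihb =>
      obtain ⟨c, hc, rfl⟩ := iha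
      obtain ⟨d, hd, rfl⟩ := ihb
      exact ⟨c + d, fun j => by simp [hc, hd], by simp⟩
  -- regularity
  have hJε : ∀ j, ∀ x ∈ J j, ε x = 0 := by
    intro j x hx
    rw [hJ j] at hx
    have hle : TwoSidedIdeal.span (g '' {i | i ≠ j}) ≤ TwoSidedIdeal.ker ε := by
      rw [TwoSidedIdeal.span_le]
      rintro _ ⟨i, _, rfl⟩
      exact (TwoSidedIdeal.mem_ker ε).mpr (hgε i)
    exact (TwoSidedIdeal.mem_ker ε).mp (hle hx)
  have hfree0 : ∀ c, SemisimpleAut.comb g c = 0 → ∀ j, ε (c j) = 0 := by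
    intro c hc j
    apply hJε j
    have h1 : g j * c j ∈ J j := by
      rw [SemisimpleAut.comb_apply, ← Finset.add_sum_erase _ _ (Finset.mem_univ j)] at hc
      rw [eq_neg_of_add_eq_zero_left hc]
      apply TwoSidedIdeal.neg_mem
      apply sum_mem
      intro i hi
      apply TwoSidedIdeal.mul_mem_right
      rw [hJ j]
      exact TwoSidedIdeal.subset_span ⟨i, Finset.ne_of_mem_erase hi, rfl⟩
    have hmk : ∀ x, (J j).ringCon.mk' x = 0 ↔ x ∈ J j := by
      intro x
      rw [TwoSidedIdeal.mem_iff, ← RingCon.eq]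
      rfl
    rw [← hmk]
    apply (hreg j _).1
    rw [← map_mul, hmk]
    exact h1
  have hfree : ∀ c d, SemisimpleAut.comb g c = SemisimpleAut.comb g d →
      ∀ j, ε (c j) = ε (d j) := by
    intro c d h j
    have := hfree0 (c - d) (by rw [map_sub, h, sub_self]) j
    simpa [sub_eq_zero] using this
  -- the ideal `Q = I * ker ε`
  let P : Subalgebra ℂ (UniversalEnvelopingAlgebra ℂ L) :=
    { carrier := {x | ∃ c, (∀ j, ε (c j) = 0) ∧ SemisimpleAut.comb g c = φ x - x}
      mul_mem' := by
        rintro x y ⟨c, hc, hcx⟩ ⟨d, hd, hdy⟩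
        refine ⟨(fun j => c j * φ y) + (fun j => x * d j), fun j => by simp [hc, hd], ?_⟩
        rw [map_add, ← SemisimpleAut.comb_mul, ← SemisimpleAut.mul_comb g hg, hcx, hdy, map_mul]
        noncomm_ring
      add_mem' := by
        rintro x y ⟨c, hc, hcx⟩ ⟨d, hd, hdy⟩
        refine ⟨c + d, fun j => by simp [hc, hd], ?_⟩
        rw [map_add, hcx, hdy, map_add]
        abel
      algebraMap_mem' := fun r => ⟨0, fun j => by simp, by simp⟩ }
  have hP2 : ∀ x y, ε x = 0 → ε y = 0 → x * y ∈ P := by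
    intro x y hx hy
    have h1 := hφ x
    have h2 := hφ y
    have hy' : ε (φ y) = 0 := by
      have := hIε _ h2
      rw [map_sub, hy, sub_zero] at this
      exact this
    rw [hIr] at h1 h2
    obtain ⟨c, hc⟩ := h1
    obtain ⟨d, hd⟩ := h2
    refine ⟨(fun j => c j * φ y) + (fun j => x * d j), fun j => by simp [hx, hy'], ?_⟩
    rw [map_add, ← SemisimpleAut.comb_mul, ← SemisimpleAut.mul_comb g hg, hc, hd, map_mul]
    noncomm_ring
  have hPι : ∀ x : L, UniversalEnvelopingAlgebra.ι ℂ x ∈ P := by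
    intro x
    have hx : x ∈ (LieAlgebra.derivedSeries ℂ L 1).toSubmodule := by rw [hperf]; trivial
    rw [LieAlgebra.derivedSeries_def, LieAlgebra.derivedSeriesOfIdeal_succ,
      LieAlgebra.derivedSeriesOfIdeal_zero, LieSubmodule.lieIdeal_oper_eq_linear_span'] at hx
    induction hx using Submodule.span_induction with
    | mem x h =>
      obtain ⟨a, _, b, _, rfl⟩ := h
      rw [SemisimpleAut.ι_lie]
      exact P.sub_mem (hP2 _ _ (hε a) (hε b)) (hP2 _ _ (hε b) (hε a))
    | zero => rw [map_zero]; exact P.zero_mem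
    | add a b _ _ ha hb => rw [map_add]; exact P.add_mem ha hb
    | smul r a _ ha => rw [map_smul]; exact P.smul_mem ha r
  have hPtop : ∀ x, x ∈ P := SemisimpleAut.mem_of_ι_mem P hPι
  -- elements of the center
  have hZ : ∀ z ∈ Algebra.adjoin ℂ (Set.range g), ∃ (b : Fin n → ℂ),
      ∃ w ∈ I * I, z = algebraMap ℂ _ (ε z) +
        SemisimpleAut.comb g (fun j => algebraMap ℂ _ (b j)) + w := by
    intro z hz
    induction hz using Algebra.adjoin_induction with
    | mem x h =>
      obtain ⟨i, rfl⟩ := h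
      refine ⟨Pi.single i 1, 0, Submodule.zero_mem _, ?_⟩
      rw [SemisimpleAut.comb_apply, Finset.sum_eq_single i]
      · simp [hgε]
      · intro b _ hb
        simp [hb]
      · simp
    | algebraMap r =>
      refine ⟨0, 0, Submodule.zero_mem _, ?_⟩
      simp [SemisimpleAut.comb_apply]
    | add x y _ _ hx hy =>
      obtain ⟨b, w, hw, hx⟩ := hx
      obtain ⟨b', w', hw', hy⟩ := hy
      refine ⟨b + b', w + w', Submodule.add_mem _ hw hw', ?_⟩
      have : (fun j => algebraMap ℂ (UniversalEnvelopingAlgebra ℂ L) ((b + b') j)) =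
        (fun j => algebraMap ℂ _ (b j)) + (fun j => algebraMap ℂ _ (b' j)) := by
        ext j; simp
      rw [this, map_add, map_add, map_add]
      nth_rewrite 1 [hx]
      nth_rewrite 1 [hy]
      abel
    | mul x y _ _ hx hy =>
      obtain ⟨b, w, hw, hx⟩ := hx
      obtain ⟨b', w', hw', hy⟩ := hy
      have hle : I * I ≤ I := Submodule.mul_le.mpr fun a ha b _ => hImul a ha b
      have hxI : x - algebraMap ℂ _ (ε x) ∈ I := by
        have : x - algebraMap ℂ _ (ε x) =
          SemisimpleAut.comb g (fun j => algebraMap ℂ _ (b j)) + w := by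
          nth_rewrite 1 [hx]; abel
        rw [this]
        exact I.add_mem (hIr ▸ ⟨_, rfl⟩) (hle hw)
      have hyI : y - algebraMap ℂ _ (ε y) ∈ I := by
        have : y - algebraMap ℂ _ (ε y) =
          SemisimpleAut.comb g (fun j => algebraMap ℂ _ (b' j)) + w' := by
          nth_rewrite 1 [hy]; abel
        rw [this]
        exact I.add_mem (hIr ▸ ⟨_, rfl⟩) (hle hw')
      refine ⟨ε x • b' + ε y • b, ε x • w' + ε y • w +
        (x - algebraMap ℂ _ (ε x)) * (y - algebraMap ℂ _ (ε y)),
        Submodule.add_mem _ (Submodule.add_mem _ (Submodule.smul_mem _ _ hw')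
          (Submodule.smul_mem _ _ hw)) (Submodule.mul_mem_mul hxI hyI), ?_⟩
      have : (fun j => algebraMap ℂ (UniversalEnvelopingAlgebra ℂ L)
          ((ε x • b' + ε y • b) j)) =
        ε x • (fun j => algebraMap ℂ (UniversalEnvelopingAlgebra ℂ L) (b' j)) +
          ε y • (fun j => algebraMap ℂ (UniversalEnvelopingAlgebra ℂ L) (b j)) := by
        ext j; simp [Algebra.smul_def]
      rw [this, map_add, map_smul, map_smul]
      have e1 : SemisimpleAut.comb g (fun j => algebraMap ℂ _ (b j)) =
        x - algebraMap ℂ _ (ε x) - w := by nth_rewrite 1 [hx]; abel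
      have e2 : SemisimpleAut.comb g (fun j => algebraMap ℂ _ (b' j)) =
        y - algebraMap ℂ _ (ε y) - w' := by nth_rewrite 1 [hy]; abel
      rw [e1, e2]
      simp only [map_mul, Algebra.algebraMap_eq_smul_one, smul_sub, mul_sub, sub_mul,
        smul_mul_assoc, mul_smul_comm, one_mul, mul_one, smul_smul, mul_comm (ε y) (ε x)]
      abel
  -- `φ` is trivial on the generators modulo `I * I`
  have hφg : ∀ i, φ (g i) - g i ∈ I * I := by
    intro i
    have hc : φ (g i) - g i ∈ Algebra.adjoin ℂ (Set.range g) := by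
      rw [← hgen]
      refine Subalgebra.sub_mem _ ?_ (hgc i)
      rw [Subalgebra.mem_center_iff]
      intro b
      obtain ⟨a, rfl⟩ := φ.surjective b
      rw [← map_mul, hg, map_mul]
    obtain ⟨b, w, hw, h⟩ := hZ _ hc
    rw [hIε _ (hφ _), map_zero, zero_add] at h
    obtain ⟨c, hcε, hcx⟩ := hPtop (g i)
    obtain ⟨d, hdε, rfl⟩ := hII w hw
    have hb : b = 0 := by
      ext j
      rw [h, ← map_add] at hcx
      have := hfree _ _ hcx j
      simpa [hcε, hdε] using this.symm
    rw [h, hb]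
    simpa [SemisimpleAut.comb_apply] using hw
  have hφI : ∀ x ∈ I, φ x - x ∈ I * I := by
    intro x hx
    rw [hIr] at hx
    obtain ⟨c, rfl⟩ := hx
    rw [SemisimpleAut.comb_apply, map_sum, ← Finset.sum_sub_distrib]
    refine Submodule.sum_mem _ fun j _ => ?_
    have : φ (g j * c j) - g j * c j = (φ (g j) - g j) * φ (c j) + g j * (φ (c j) - c j) := by
      rw [map_mul]; noncomm_ring
    rw [this]
    refine Submodule.add_mem _ ?_ (Submodule.mul_mem_mul (hIg j) (hφ _))
    have : ∀ x ∈ I * I, ∀ u, x * u ∈ I * I := by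
      intro x hx u
      induction hx using Submodule.mul_induction_on' with
      | mem_mul_mem a ha b hb =>
        rw [mul_assoc]; exact Submodule.mul_mem_mul ha (hImul b hb u)
      | add a _ b _ iha ihb => rw [add_mul]; exact Submodule.add_mem _ iha ihb
    exact this _ (hφg j) _
  -- filtration
  have hF : ∀ k, ∀ x ∈ I ^ (k + 1), φ x - x ∈ I ^ (k + 2) := by
    intro k
    induction k with
    | zero => intro x hx; rw [zero_add, pow_one] at hx; rw [pow_two]; exact hφI x hx
    | succ k ih =>
      intro x hx
      rw [pow_succ] at hx
      induction hx using Submodule.mul_induction_on' with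
      | mem_mul_mem a ha b hb =>
        have hφb : φ b ∈ I := by
          have := I.add_mem (hφ b) hb
          simpa using this
        have : φ (a * b) - a * b = (φ a - a) * φ b + a * (φ b - b) := by
          rw [map_mul]; noncomm_ring
        rw [this]
        refine Submodule.add_mem _ ?_ ?_
        · rw [show k + 1 + 2 = (k + 2) + 1 by ring, pow_succ]
          exact Submodule.mul_mem_mul (ih a ha) hφb
        · rw [show k + 1 + 2 = (k + 1) + 2 by ring, pow_add, pow_two]
          exact Submodule.mul_mem_mul ha (hφI b hb)
      | add a _ b _ iha ihb =>
        rw [map_add, add_sub_add_comm]; exact Submodule.add_mem _ iha ihb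
  have hmono : ∀ k, I ^ (k + 2) ≤ I ^ (k + 1) := by
    intro k
    rw [show k + 2 = k + (1 + 1) by ring, pow_add, pow_add I k 1, pow_succ, pow_one]
    exact mul_le_mul_right (Submodule.mul_le.mpr fun a ha b _ => hImul a ha b) _
  ext1 v
  refine SemisimpleAut.eq_of_filtration φ.toLinearMap hss
    (fun k => match k with | 0 => ⊤ | k + 1 => I ^ (k + 1)) rfl ?_ ?_ hint v
  · intro k
    cases k with
    | zero => exact le_top
    | succ k => exact hmono k
  · intro k x hx
    cases k with
    | zero => simpa using hφ x
    | succ k => exact hF k x hx
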